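/- arXiv:2101.03573 — 2 statements merged into one kernel-verified Lean document; each statement's English description precedes it below -/
import Mathlib

section
/- Let Q = (J,σ,ξ) be a Q-datum, and let i,j ∈ I₀ satisfy i ∼ j and 𝗌_i = 𝗌_j. Fix ι ∈ J^{(i)}. Then a vertex ȷ ∈ J^{(j)} satisfies ξ_ȷ ≡ ξ_ι + 𝗌_i (mod 2𝗌_i) if and only if ι ∼ ȷ. -/
open scoped BigOperators Classical

namespace QDatumPaper

structure CartanADE (J : Type) [Fintype J] [DecidableEq J] where
  a : J → J → ℤ
  symm : ∀ ι j : J, a ι j = a j ι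
  diag : ∀ ι : J, a ι ι = 2
  offDiag : ∀ ι j : J, ι ≠ j → a ι j = 0 ∨ a ι j = -1
  posDef : ∀ v : J → ℚ, v ≠ 0 → 0 < ∑ ι : J, ∑ j : J, v ι * (a ι j : ℚ) * v j
  indec : ∀ s : Set J, s.Nonempty →
    (∀ ι ∈ s, ∀ j : J, a ι j = -1 → j ∈ s) → s = Set.univ

variable {J : Type} [Fintype J] [DecidableEq J]

/-- `j` lies in the `σ`-orbit of `ι`. -/
def SameOrbit (σ : Equiv.Perm J) (ι j : J) : Prop := ∃ k : ℕ, (σ ^ k) ι = j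

/-- The size `𝗌_{\barι}` of the `σ`-orbit of `ι`. -/
noncomputable def orbitSize (σ : Equiv.Perm J) (ι : J) : ℕ :=
  ((Finset.range (orderOf σ)).image fun k => (σ ^ k) ι).card

/-- A diagram automorphism of the Cartan matrix `C`: no two distinct vertices in a common
orbit are adjacent. -/
structure DiagAut (C : CartanADE J) where
  σ : Equiv.Perm J
  compat : ∀ ι j : J, C.a (σ ι) (σ j) = C.a ι j
  noAdj : ∀ (ι : J) (k : ℕ), (σ ^ k) ι ≠ ι → C.a ι ((σ ^ k) ι) ≠ -1

/-- Height function on `(J, σ)`. -/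
def IsHeightFunction (C : CartanADE J) (D : DiagAut C) (ξ : J → ℤ) : Prop :=
  (∀ ι j : J, C.a ι j = -1 → orbitSize D.σ ι = orbitSize D.σ j →
      |ξ ι - ξ j| = (orbitSize D.σ ι : ℤ)) ∧
  (∀ ι j : J, C.a ι j = -1 → orbitSize D.σ ι < orbitSize D.σ j →
      ∃! j0 : J, SameOrbit D.σ j j0 ∧ |ξ ι - ξ j0| = 1 ∧
        ∀ k : ℕ, k < orderOf D.σ → ξ ((D.σ ^ k) j0) = ξ j0 - 2 * (k : ℤ))

/-- Symmetric bilinear form on the root lattice `ℤ^J`. -/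
def pairing (C : CartanADE J) (v w : J → ℤ) : ℤ := ∑ ι : J, ∑ j : J, v ι * C.a ι j * w j

/-- Positive roots. -/
def posRoots (C : CartanADE J) : Set (J → ℤ) :=
  {v | (∀ ι : J, 0 ≤ v ι) ∧ v ≠ 0 ∧ pairing C v v = 2}

def simpleRoot (ι : J) : J → ℤ := fun j => if j = ι then 1 else 0

/-- Simple reflection `s_ι` on the root lattice. -/
def reflS (C : CartanADE J) (ι : J) (v : J → ℤ) : J → ℤ :=
  fun j => v j - (∑ κ : J, v κ * C.a κ ι) * simpleRoot ι j

/-- `applyRefls C [ι₁, …, ι_m] v = s_{ι₁}(s_{ι₂}(⋯ s_{ι_m}(v)⋯))`. -/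
def applyRefls (C : CartanADE J) (w : List J) (v : J → ℤ) : J → ℤ :=
  w.foldr (reflS C) v

/-- `β_k = s_{ι₁} ⋯ s_{ι_{k-1}} (α_{ι_k})`. -/
def betaOf (C : CartanADE J) {L : ℕ} (ii : Fin L → J) (k : Fin L) : J → ℤ :=
  applyRefls C ((List.ofFn ii).take k.1) (simpleRoot (ii k))

/-- `ii` is a reduced word of the longest element. -/
def IsReducedWord (C : CartanADE J) {L : ℕ} (ii : Fin L → J) : Prop :=
  L = (posRoots C).ncard ∧ Function.Injective (betaOf C ii) ∧
    ∀ k : Fin L, betaOf C ii k ∈ posRoots C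

def pairingQ (C : CartanADE J) (v w : J → ℚ) : ℚ :=
  ∑ ι : J, ∑ j : J, v ι * (C.a ι j : ℚ) * w j

def reflQ (C : CartanADE J) (ι : J) (v : J → ℚ) : J → ℚ :=
  fun j => v j - (∑ κ : J, v κ * (C.a κ ι : ℚ)) * (if j = ι then 1 else 0)

def applyReflsQ (C : CartanADE J) (w : List J) (v : J → ℚ) : J → ℚ :=
  w.foldr (reflQ C) v

/-- `Λ` is a system of fundamental weights: `(Λ_ι, α_j) = δ_{ιj}`. -/
def IsFundWeights (C : CartanADE J) (Λ : J → J → ℚ) : Prop :=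
  ∀ ι j : J, pairingQ C (Λ ι) (fun κ => (simpleRoot j κ : ℚ)) = if ι = j then 1 else 0

/-- `ν_k = -(s_{ι₁} ⋯ s_{ι_k})(Λ_{ι_k})`. -/
def nuOf (C : CartanADE J) {L : ℕ} (ii : Fin L → J) (Λ : J → J → ℚ) (k : Fin L) : J → ℚ :=
  - applyReflsQ C ((List.ofFn ii).take (k.1 + 1)) (Λ (ii k))

def betaQ (C : CartanADE J) {L : ℕ} (ii : Fin L → J) (k : Fin L) : J → ℚ :=
  fun j => (betaOf C ii k j : ℚ)

/-- The pairing `(ν_k, β_t)`. -/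
def nuBetaPair (C : CartanADE J) {L : ℕ} (ii : Fin L → J) (Λ : J → J → ℚ) (k t : Fin L) : ℚ :=
  pairingQ C (nuOf C ii Λ k) (betaQ C ii t)

/-- `m` is a Kostant partition of `β`. -/
def IsKP (C : CartanADE J) (β : J → ℤ) (m : (J → ℤ) → ℤ) : Prop :=
  (∀ v : J → ℤ, v ∉ posRoots C → m v = 0) ∧ (∀ v ∈ posRoots C, 0 ≤ m v) ∧
    ∑ᶠ v ∈ posRoots C, m v • v = β

/-- `ρ^ii(m)_r = Σ_{t ≤ r} m(β_t)(ν_r, β_t)`. -/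
def rhoOf (C : CartanADE J) {L : ℕ} (ii : Fin L → J) (Λ : J → J → ℚ)
    (m : (J → ℤ) → ℤ) (r : Fin L) : ℚ :=
  ∑ t ∈ Finset.univ.filter (fun t : Fin L => t ≤ r),
    (m (betaOf C ii t) : ℚ) * nuBetaPair C ii Λ r t

/-- The partial order `≼_ii` on Kostant partitions. -/
def kpLE (C : CartanADE J) {L : ℕ} (ii : Fin L → J) (Λ : J → J → ℚ)
    (m n : (J → ℤ) → ℤ) : Prop :=
  ∀ r : Fin L, rhoOf C ii Λ m r ≤ rhoOf C ii Λ n r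

/-- The height function obtained from `ξ` by applying sources `w = [ι₁, …, ι_k]`. -/
noncomputable def heightAfter (σ : Equiv.Perm J) (ξ : J → ℤ) (w : List J) : J → ℤ :=
  w.foldl (fun η ι => fun j => η j - if j = ι then 2 * (orbitSize σ ι : ℤ) else 0) ξ

def IsSource (C : CartanADE J) (ξ : J → ℤ) (ι : J) : Prop :=
  ∀ j : J, C.a ι j = -1 → ξ j < ξ ι

/-- `ii` is adapted to the Q-datum `(J, σ, ξ)`. -/
def IsAdapted (C : CartanADE J) (D : DiagAut C) (ξ : J → ℤ) {L : ℕ} (ii : Fin L → J) : Prop :=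
  ∀ k : Fin L, IsSource C (heightAfter D.σ ξ ((List.ofFn ii).take k.1)) (ii k)

/-- `(s_{ι_{k-1}} ⋯ s_{ι_1} ξ)_{ι_k}`, the second component of `Ω̃_Q(β_k)`. -/
noncomputable def heightAt (σ : Equiv.Perm J) (ξ : J → ℤ) {L : ℕ} (ii : Fin L → J) (k : Fin L) : ℤ :=
  heightAfter σ ξ ((List.ofFn ii).take k.1) (ii k)

/-- `x ∈ Im Ω̃_Q`. -/
def InImOmega (σ : Equiv.Perm J) (ξ : J → ℤ) {L : ℕ} (ii : Fin L → J) (x : J × ℤ) : Prop :=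
  ∃ k : Fin L, ii k = x.1 ∧ heightAt σ ξ ii k = x.2

/-- A single commutation move. -/
def CommStep (C : CartanADE J) {L : ℕ} (ii jj : Fin L → J) : Prop :=
  ∃ (k : ℕ) (h1 : k < L) (h2 : k + 1 < L),
    C.a (ii ⟨k, h1⟩) (ii ⟨k + 1, h2⟩) = 0 ∧
    jj = ii ∘ Equiv.swap (⟨k, h1⟩ : Fin L) ⟨k + 1, h2⟩

/-- Commutation equivalence of words. -/
def CommEquiv (C : CartanADE J) {L : ℕ} (ii jj : Fin L → J) : Prop :=
  Relation.ReflTransGen (CommStep C) ii jj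

/-- The orbits of `ι` and `j` are adjacent (`\barι ∼ \barj` in `I₀`). -/
def adjOrbit (C : CartanADE J) (σ : Equiv.Perm J) (ι j : J) : Prop :=
  ∃ ι' j' : J, SameOrbit σ ι ι' ∧ SameOrbit σ j j' ∧ C.a ι' j' = -1

/-- `c ι j` is the Cartan matrix `c_{\barι \barj}` of the folded algebra `𝔤₀`. -/
noncomputable def IsFoldedCartan (C : CartanADE J) (σ : Equiv.Perm J) (c : J → J → ℤ) : Prop :=
  ∀ ι j : J, (c ι j : ℚ) =
    if SameOrbit σ ι j then 2
    else if adjOrbit C σ ι j then -(max 1 ((orbitSize σ j : ℚ) / (orbitSize σ ι : ℚ)))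
    else 0

/-- The basis element `ϖ_{\barι, p}` of `𝒫_ℤ`, realized as a function on `J × ℤ`
(the indicator of `orbit(ι) × {p}`). -/
noncomputable def varpiF (σ : Equiv.Perm J) (ι : J) (p : ℤ) : (J × ℤ) → ℤ :=
  fun y => if SameOrbit σ ι y.1 ∧ y.2 = p then 1 else 0

/-- The ℓ-root `α_{\barι, p}`. -/
noncomputable def lrootF (σ : Equiv.Perm J) (c : J → J → ℤ) (ι : J) (p : ℤ) : (J × ℤ) → ℤ :=
  fun y => varpiF σ ι (p + (orbitSize σ ι : ℤ)) y + varpiF σ ι (p - (orbitSize σ ι : ℤ)) y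
    - (if (¬ SameOrbit σ ι y.1) ∧
          ∃ k : ℤ, 1 ≤ k ∧ k ≤ -(c y.1 ι) ∧ y.2 = p - c y.1 ι + 1 - 2 * k
       then 1 else 0)

/-- `(\barι, p + 𝗌_{\barι}) ∈ Î₀`, i.e. the index `(\barι,p)` gives a valid ℓ-root. -/
def ValidLRootIdx (σ : Equiv.Perm J) (ξ : J → ℤ) (ι : J) (p : ℤ) : Prop :=
  (2 : ℤ) ∣ (p + (orbitSize σ ι : ℤ) - ξ ι)

/-- The set of all ℓ-roots (generating `𝒬_ℤ`). -/
noncomputable def lrootSet (σ : Equiv.Perm J) (ξ : J → ℤ) (c : J → J → ℤ) :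
    Set ((J × ℤ) → ℤ) :=
  {x | ∃ (ι : J) (p : ℤ), ValidLRootIdx σ ξ ι p ∧ x = lrootF σ c ι p}

/-- The ℤ-linear map `Ω_Q : ℤ^{R⁺} → 𝒫_ℤ`. -/
noncomputable def OmegaQmap (C : CartanADE J) (σ : Equiv.Perm J) (ξ : J → ℤ) {L : ℕ}
    (ii : Fin L → J) (m : (J → ℤ) → ℤ) : (J × ℤ) → ℤ :=
  ∑ k : Fin L, m (betaOf C ii k) • varpiF σ (ii k) (heightAt σ ξ ii k)

theorem orbitSize_eq (σ : Equiv.Perm J) (x : J) :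
    orbitSize σ x = Function.minimalPeriod σ x := by
  unfold orbitSize
  have hpow : ∀ k : ℕ, (σ ^ k) x = σ^[k] x := fun k => by
    rw [Equiv.Perm.iterate_eq_pow]
  have hn : 0 < orderOf σ := orderOf_pos σ
  have hper : Function.IsPeriodicPt σ (orderOf σ) x := by
    unfold Function.IsPeriodicPt Function.IsFixedPt
    rw [← hpow, pow_orderOf_eq_one]; rfl
  have hp : 0 < Function.minimalPeriod σ x := hper.minimalPeriod_pos hn
  have hle : Function.minimalPeriod σ x ≤ orderOf σ := hper.minimalPeriod_le hn
  have himg : ((Finset.range (orderOf σ)).image fun k => (σ ^ k) x)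
      = (Finset.range (Function.minimalPeriod σ x)).image fun k => (σ ^ k) x := by
    ext y
    simp only [Finset.mem_image, Finset.mem_range]
    constructor
    · rintro ⟨k, hk, rfl⟩
      refine ⟨k % Function.minimalPeriod σ x, Nat.mod_lt _ hp, ?_⟩
      rw [hpow, hpow, Function.iterate_mod_minimalPeriod_eq]
    · rintro ⟨k, hk, rfl⟩
      exact ⟨k, lt_of_lt_of_le hk hle, rfl⟩
  rw [himg, Finset.card_image_of_injOn, Finset.card_range]
  intro a ha b hb hab
  simp only [Finset.coe_range, Set.mem_Iio] at ha hb
  simp only [hpow] at hab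
  have h := (Function.iterate_eq_iterate_iff_of_lt_minimalPeriod ha hb).1 hab
  exact h

theorem pow_eq_iff (σ : Equiv.Perm J) (x : J) (k : ℕ) :
    (σ ^ k) x = x ↔ orbitSize σ x ∣ k := by
  rw [orbitSize_eq, ← Function.isPeriodicPt_iff_minimalPeriod_dvd]
  unfold Function.IsPeriodicPt Function.IsFixedPt
  rw [Equiv.Perm.iterate_eq_pow]

theorem orbitSize_pos (σ : Equiv.Perm J) (x : J) : 0 < orbitSize σ x := by
  apply Nat.pos_of_dvd_of_pos ((pow_eq_iff σ x (orderOf σ)).1 _) (orderOf_pos σ)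
  rw [pow_orderOf_eq_one]; rfl

theorem orbitSize_pow (σ : Equiv.Perm J) (x : J) (k : ℕ) :
    orbitSize σ ((σ ^ k) x) = orbitSize σ x := by
  have key : ∀ m : ℕ, orbitSize σ ((σ ^ k) x) ∣ m ↔ orbitSize σ x ∣ m := by
    intro m
    rw [← pow_eq_iff, ← pow_eq_iff, ← Equiv.Perm.mul_apply, ← pow_add, add_comm, pow_add,
      Equiv.Perm.mul_apply]
    exact (σ ^ k).apply_eq_iff_eq
  exact Nat.dvd_antisymm ((key _).2 dvd_rfl) ((key _).1 dvd_rfl)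

/-- Every power can be undone by a further power. -/
theorem exists_inv_pow (σ : Equiv.Perm J) (k : ℕ) : ∃ m : ℕ, σ ^ m * σ ^ k = 1 := by
  have h0 : 0 < orderOf σ := orderOf_pos σ
  refine ⟨k * (orderOf σ - 1), ?_⟩
  rw [← pow_add]
  have : k * (orderOf σ - 1) + k = orderOf σ * k := by
    obtain ⟨n, hn⟩ := Nat.exists_eq_succ_of_ne_zero h0.ne'
    rw [hn]; simp; ring
  rw [this, pow_mul, pow_orderOf_eq_one, one_pow]

theorem compat_pow {C : CartanADE J} (D : DiagAut C) (k : ℕ) (x y : J) :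
    C.a ((D.σ ^ k) x) ((D.σ ^ k) y) = C.a x y := by
  induction k with
  | zero => simp
  | succ k ih => rw [pow_succ', Equiv.Perm.mul_apply, Equiv.Perm.mul_apply, D.compat, ih]

/-- Heights decrease by two along the orbit, modulo twice the orbit size. -/
def HProp (σ : Equiv.Perm J) (ξ : J → ℤ) (x : J) : Prop :=
  ∀ k : ℕ, (2 * (orbitSize σ x : ℤ)) ∣ ξ ((σ ^ k) x) - ξ x + 2 * (k : ℤ)

theorem HProp.pow {σ : Equiv.Perm J} {ξ : J → ℤ} {x : J} (h : HProp σ ξ x) (m : ℕ) :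
    HProp σ ξ ((σ ^ m) x) := by
  intro k
  rw [orbitSize_pow, ← Equiv.Perm.mul_apply, ← pow_add]
  have := dvd_sub (h (k + m)) (h m)
  rw [Nat.cast_add] at this
  refine dvd_trans this (dvd_of_eq ?_)
  ring

theorem HProp.of_fixed {σ : Equiv.Perm J} {ξ : J → ℤ} {x : J} (h : σ x = x) :
    HProp σ ξ x := by
  have h1 : orbitSize σ x = 1 := Nat.dvd_one.1 ((pow_eq_iff σ x 1).1 (by simpa using h))
  intro k
  have : (σ ^ k) x = x := (pow_eq_iff σ x k).2 (by rw [h1]; exact one_dvd _)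
  rw [this, h1]
  exact ⟨k, by push_cast; ring⟩

theorem edge_mod {s d : ℤ} (h : |d| = s) : 2 * s ∣ d + s := by
  rcases abs_choice d with h' | h' <;> rw [h'] at h
  · exact ⟨1, by linarith⟩
  · exact ⟨0, by linarith⟩

theorem HProp.step {C : CartanADE J} {D : DiagAut C} {ξ : J → ℤ}
    (hξ : IsHeightFunction C D ξ) {u l : J} (hadj : C.a u l = -1)
    (hle : orbitSize D.σ u ≤ orbitSize D.σ l) (hu : HProp D.σ ξ u) : HProp D.σ ξ l := by
  rcases hle.eq_or_lt with heq | hlt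
  · intro k
    have e0 := edge_mod (hξ.1 u l hadj heq)
    have e1 := edge_mod (hξ.1 ((D.σ ^ k) u) ((D.σ ^ k) l) (by rw [compat_pow, hadj])
      (by rw [orbitSize_pow, orbitSize_pow, heq]))
    rw [orbitSize_pow] at e1
    have := dvd_add (dvd_sub (hu k) e1) e0
    rw [← heq]
    refine dvd_trans this (dvd_of_eq ?_)
    ring
  · obtain ⟨j0, ⟨⟨c, hc⟩, -, hk⟩, -⟩ := hξ.2 u l hadj hlt
    have hs : orbitSize D.σ j0 = orbitSize D.σ l := by rw [← hc, orbitSize_pow]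
    have hdv : orbitSize D.σ j0 ∣ orderOf D.σ :=
      (pow_eq_iff _ _ _).1 (by rw [pow_orderOf_eq_one]; rfl)
    have hn : orbitSize D.σ j0 = orderOf D.σ := by
      refine le_antisymm (Nat.le_of_dvd (orderOf_pos _) hdv) (not_lt.1 fun hlt' => ?_)
      have h := hk _ hlt'
      rw [(pow_eq_iff _ _ _).2 dvd_rfl] at h
      have := orbitSize_pos D.σ j0
      omega
    have hj0 : HProp D.σ ξ j0 := by
      intro k
      have h := hk (k % orderOf D.σ) (Nat.mod_lt _ (orderOf_pos _))
      rw [pow_mod_orderOf] at h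
      rw [h, hn]
      refine ⟨((k / orderOf D.σ : ℕ) : ℤ), ?_⟩
      have h2 : ((k % orderOf D.σ : ℕ) : ℤ) + (orderOf D.σ : ℤ) * ((k / orderOf D.σ : ℕ) : ℤ)
        = (k : ℤ) := by exact_mod_cast Nat.mod_add_div k (orderOf D.σ)
      linear_combination (-2) * h2
    obtain ⟨m, hm⟩ := exists_inv_pow D.σ c
    have : (D.σ ^ m) j0 = l := by
      rw [← hc, ← Equiv.Perm.mul_apply, hm]; rfl
    rw [← this]
    exact hj0.pow m

/-- Any nonempty set of vertices contains one with at most one neighbour in the set. -/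
theorem exists_leaf (C : CartanADE J) (S : Finset J) (hS : S.Nonempty) :
    ∃ x ∈ S, ∀ y ∈ S, ∀ z ∈ S, C.a x y = -1 → C.a x z = -1 → y = z := by
  have hpos := C.posDef (fun x => if x ∈ S then 1 else 0) (by
    obtain ⟨x, hx⟩ := hS
    intro h
    have := congrFun h x
    simp [hx] at this)
  have hsum : (0 : ℤ) < ∑ x ∈ S, ∑ y ∈ S, C.a x y := by
    have : (∑ ι : J, ∑ j : J, (if ι ∈ S then (1 : ℚ) else 0) * (C.a ι j : ℚ) *
        (if j ∈ S then (1 : ℚ) else 0)) = ((∑ x ∈ S, ∑ y ∈ S, C.a x y : ℤ) : ℚ) := by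
      push_cast
      simp [← Finset.sum_filter, ite_mul, Finset.sum_ite_mem]
    rw [this] at hpos
    exact_mod_cast hpos
  obtain ⟨x, hx, hxp⟩ := Finset.exists_lt_of_sum_lt (s := S) (f := fun _ => (0 : ℤ))
    (g := fun x => ∑ y ∈ S, C.a x y) (by simpa using hsum)
  refine ⟨x, hx, fun y hy z hz hxy hxz => ?_⟩
  by_contra hne
  have hxy' : x ≠ y := by rintro rfl; rw [C.diag] at hxy; norm_num at hxy
  have hxz' : x ≠ z := by rintro rfl; rw [C.diag] at hxz; norm_num at hxz
  have hsub : ({x, y, z} : Finset J) ⊆ S := by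
    intro w; simp only [Finset.mem_insert, Finset.mem_singleton]
    rintro (rfl | rfl | rfl) <;> assumption
  have h3 : ∑ w ∈ ({x, y, z} : Finset J), C.a x w = 0 := by
    rw [Finset.sum_insert (by simp [hxy', hxz']), Finset.sum_pair hne, C.diag, hxy, hxz]
    norm_num
  have h4 : ∑ w ∈ S \ {x, y, z}, C.a x w ≤ 0 := by
    apply Finset.sum_nonpos
    intro w hw
    have : x ≠ w := by rintro rfl; simp at hw
    rcases C.offDiag x w this with h | h <;> rw [h] <;> norm_num
  have h5 := Finset.sum_sdiff (f := fun w => C.a x w) hsub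
  linarith

theorem HProp.all_aux {C : CartanADE J} {D : DiagAut C} {ξ : J → ℤ}
    (hξ : IsHeightFunction C D ξ) (n : ℕ) : ∀ S : Finset J, S.card = n → S.Nonempty →
    (∀ (k : ℕ) (x : J), x ∈ S → (D.σ ^ k) x ∈ S) →
    (∀ T : Set J, T.Nonempty → T ⊆ (S : Set J) →
      (∀ x ∈ T, ∀ y ∈ S, C.a x y = -1 → y ∈ T) → ∀ x ∈ S, x ∈ T) →
    ∀ x ∈ S, HProp D.σ ξ x := by
  induction n using Nat.strong_induction_on with
  | _ n ih =>
  intro S hcard hne hinv hconn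
  obtain ⟨l, hl, hleaf⟩ := exists_leaf C S hne
  by_cases hdeg : ∃ u ∈ S, C.a l u = -1
  · obtain ⟨u, hu, hlu⟩ := hdeg
    -- the leaf property is invariant under the automorphism
    have hleaf' : ∀ (k : ℕ), ∀ y ∈ S, C.a ((D.σ ^ k) l) y = -1 → y = (D.σ ^ k) u := by
      intro k y hy h
      obtain ⟨m, hm⟩ := exists_inv_pow D.σ k
      have e : ∀ w, (D.σ ^ m) ((D.σ ^ k) w) = w := fun w => by
        rw [← Equiv.Perm.mul_apply, hm]; rfl
      have h1 := compat_pow D m ((D.σ ^ k) l) y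
      rw [e, h] at h1
      have h2 := hleaf _ (hinv m y hy) u hu h1 hlu
      apply (D.σ ^ m).injective
      rw [h2, e]
    have hnotorb : ∀ k m : ℕ, (D.σ ^ k) u ≠ (D.σ ^ m) l := by
      intro k m h
      obtain ⟨q, hq⟩ := exists_inv_pow D.σ k
      have hul : u = (D.σ ^ (q + m)) l := by
        rw [pow_add, Equiv.Perm.mul_apply, ← h, ← Equiv.Perm.mul_apply, hq]; rfl
      by_cases hfix : (D.σ ^ (q + m)) l = l
      · rw [hul, hfix, C.diag] at hlu; norm_num at hlu
      · apply D.noAdj l (q + m) hfix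
        rw [← hul]; exact hlu
    let S' : Finset J := S.filter fun x => ¬ SameOrbit D.σ l x
    have hmem : ∀ x, x ∈ S' ↔ x ∈ S ∧ ¬ SameOrbit D.σ l x := fun x => Finset.mem_filter
    have huS : ∀ k, (D.σ ^ k) u ∈ S' := fun k =>
      (hmem _).2 ⟨hinv k u hu, fun ⟨m, hm⟩ => hnotorb k m hm.symm⟩
    have hlt : S'.card < n := by
      rw [← hcard]
      apply Finset.card_lt_card
      refine ⟨Finset.filter_subset _ _, fun h => ?_⟩
      exact ((hmem l).1 (h hl)).2 ⟨0, rfl⟩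
    have hS' : ∀ x ∈ S', HProp D.σ ξ x := by
      refine ih _ hlt S' rfl ⟨_, huS 0⟩ ?_ ?_
      · intro k x hx
        obtain ⟨hxS, hxo⟩ := (hmem x).1 hx
        refine (hmem _).2 ⟨hinv k x hxS, ?_⟩
        rintro ⟨m, hm⟩
        obtain ⟨q, hq⟩ := exists_inv_pow D.σ k
        apply hxo
        refine ⟨q + m, ?_⟩
        rw [pow_add, Equiv.Perm.mul_apply, hm, ← Equiv.Perm.mul_apply, hq]; rfl
      · intro T hT hTS hTc x hx
        have hbig := hconn (T ∪ {y | SameOrbit D.σ l y ∧ y ∈ S ∧ ∃ t ∈ T, C.a y t = -1})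
          (hT.mono Set.subset_union_left) (by
            rintro y (hy | hy)
            · exact ((hmem y).1 (hTS hy)).1
            · exact hy.2.1) (by
            rintro y (hy | ⟨⟨k, rfl⟩, hyS, t, ht, hyt⟩) z hz hyz
            · by_cases hzo : SameOrbit D.σ l z
              · exact Or.inr ⟨hzo, hz, y, hy, by rw [C.symm]; exact hyz⟩
              · exact Or.inl (hTc y hy z ((hmem z).2 ⟨hz, hzo⟩) hyz)
            · left
              have h1 := hleaf' k z hz hyz
              have h2 := hleaf' k t ((hmem t).1 (hTS ht)).1 hyt
              rw [h1, ← h2]; exact ht)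
        obtain ⟨hxS, hxo⟩ := (hmem x).1 hx
        rcases hbig x hxS with h | h
        · exact h
        · exact absurd h.1 hxo
    intro x hx
    by_cases hxo : SameOrbit D.σ l x
    · obtain ⟨k, rfl⟩ := hxo
      apply HProp.pow
      refine HProp.step hξ (u := u) (by rw [C.symm]; exact hlu) ?_ (hS' u (huS 0))
      apply Nat.le_of_dvd (orbitSize_pos _ _)
      rw [← pow_eq_iff]
      have h1 := compat_pow D (orbitSize D.σ l) l u
      rw [(pow_eq_iff D.σ l _).2 dvd_rfl, hlu] at h1
      exact hleaf _ (hinv _ u hu) u hu h1 hlu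
    · exact hS' x ((hmem x).2 ⟨hx, hxo⟩)
  · have hall := hconn {l} ⟨l, rfl⟩ (by rintro y rfl; exact hl) (by
      rintro x rfl y hy hxy
      exact absurd ⟨y, hy, hxy⟩ hdeg)
    intro x hx
    apply HProp.of_fixed
    have h1 : x = l := hall x hx
    have h2 : (D.σ ^ 1) x = l := hall _ (hinv 1 x hx)
    rw [pow_one] at h2
    rw [h2, h1]

theorem HProp.all {C : CartanADE J} {D : DiagAut C} {ξ : J → ℤ}
    (hξ : IsHeightFunction C D ξ) (x : J) : HProp D.σ ξ x := by
  refine HProp.all_aux hξ _ Finset.univ rfl ⟨x, Finset.mem_univ x⟩ (fun _ _ _ => Finset.mem_univ _)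
    ?_ x (Finset.mem_univ x)
  intro T hT _ hc y _
  rw [C.indec T hT fun a ha b hab => hc a ha b (Finset.mem_univ b) hab]
  exact Set.mem_univ y

/-- for a Q-datum `(J, σ, ξ)`, orbits `i = \barι`, `j = \barj` with
`i ∼ j` and `𝗌_i = 𝗌_j`, a vertex `j ∈ J^{(j)}` satisfies
`ξ_j ≡ ξ_ι + 𝗌_i (mod 2𝗌_i)` if and only if `ι ∼ j`. -/
theorem statement2 (C : CartanADE J) (D : DiagAut C) (ξ : J → ℤ)
    (hξ : IsHeightFunction C D ξ) (ι j : J)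
    (hadj : adjOrbit C D.σ ι j)
    (hs : orbitSize D.σ ι = orbitSize D.σ j) :
    ((2 * (orbitSize D.σ ι : ℤ)) ∣ (ξ j - (ξ ι + (orbitSize D.σ ι : ℤ)))) ↔
      C.a ι j = -1 := by
  constructor
  · intro hdvd
    obtain ⟨i', j', ⟨p, rfl⟩, ⟨q, rfl⟩, hij⟩ := hadj
    obtain ⟨m, hm⟩ := exists_inv_pow D.σ p
    obtain ⟨r, hr⟩ := exists_inv_pow D.σ (m + q)
    have h1 := compat_pow D m ((D.σ ^ p) ι) ((D.σ ^ q) j)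
    rw [← Equiv.Perm.mul_apply, hm, ← Equiv.Perm.mul_apply, ← pow_add, hij,
      Equiv.Perm.one_apply] at h1
    have hsz : orbitSize D.σ ι = orbitSize D.σ ((D.σ ^ (m + q)) j) := by
      rw [orbitSize_pow, hs]
    have h2 := edge_mod (hξ.1 _ _ h1 hsz)
    have h3 := HProp.all hξ j (m + q)
    rw [← hs] at h3
    have h4 := dvd_add (dvd_add h2 h3) hdvd
    have h5 : (2 * (orbitSize D.σ ι : ℤ)) ∣ 2 * ((m + q : ℕ) : ℤ) := by
      refine dvd_trans h4 (dvd_of_eq ?_)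
      ring
    have h6 : orbitSize D.σ ι ∣ m + q := by
      have := (mul_dvd_mul_iff_left (two_ne_zero : (2 : ℤ) ≠ 0)).1 h5
      exact_mod_cast this
    rw [hs] at h6
    rw [(pow_eq_iff D.σ j _).2 h6] at h1
    exact h1
  · intro h
    have h1 := edge_mod (hξ.1 ι j h hs)
    have h2 : (2 * (orbitSize D.σ ι : ℤ)) ∣ -(ξ ι - ξ j + (orbitSize D.σ ι : ℤ)) :=
      (dvd_neg).2 h1
    refine dvd_trans h2 (dvd_of_eq ?_)
    ring


end QDatumPaper
end

section
/- Let Q = (J,σ,ξ) be a Q-datum, and let 𝐢 = (ι_1,…,ι_L) and 𝐣 be two reduced words of w₀ both adapted to Q. Then the maps Ω̃_Q : R⁺ → J × ℤ defined from 𝐢 and from 𝐣 coincide. That is, the assignment β_k ↦ (ι_k, (s_{ι_{k−1}}⋯s_{ι_1}ξ)_{ι_k}) does not depend on the choice of Q-adapted reduced word. -/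
open scoped BigOperators Classical

namespace QDatumPaper

variable {J : Type} [Fintype J] [DecidableEq J]

/-! ### Auxiliary list-based development -/

/-- Height function after firing one vertex. -/
noncomputable def fireH (σ : Equiv.Perm J) (ξ : J → ℤ) (ι : J) : J → ℤ :=
  fun j => ξ j - if j = ι then 2 * (orbitSize σ ι : ℤ) else 0

/-- The list of triples `(β_k, ι_k, height)` attached to a word. -/
noncomputable def tripL (C : CartanADE J) (σ : Equiv.Perm J) :
    (J → ℤ) → List J → List ((J → ℤ) × J × ℤ)
  | _, [] => []
  | ξ, ι :: w => (simpleRoot ι, ι, ξ ι) ::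
      (tripL C σ (fireH σ ξ ι) w).map (fun t => (reflS C ι t.1, t.2))

/-- Recursive form of adaptedness. -/
def AdL (C : CartanADE J) (σ : Equiv.Perm J) : (J → ℤ) → List J → Prop
  | _, [] => True
  | ξ, ι :: w => IsSource C ξ ι ∧ AdL C σ (fireH σ ξ ι) w

lemma fireH_le (σ : Equiv.Perm J) (ξ : J → ℤ) (ι j : J) : fireH σ ξ ι j ≤ ξ j := by
  unfold fireH
  split_ifs <;> omega

lemma fireH_ne (σ : Equiv.Perm J) (ξ : J → ℤ) {ι j : J} (h : j ≠ ι) :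
    fireH σ ξ ι j = ξ j := by
  simp [fireH, h]

lemma source_fire {C : CartanADE J} (σ : Equiv.Perm J) {ξ : J → ℤ} {ι j : J}
    (h : IsSource C ξ ι) (hne : ι ≠ j) : IsSource C (fireH σ ξ j) ι := by
  intro k hk
  rw [fireH_ne σ ξ hne]
  exact lt_of_le_of_lt (fireH_le σ ξ j k) (h k hk)

lemma fireH_comm (σ : Equiv.Perm J) (ξ : J → ℤ) (ι j : J) :
    fireH σ (fireH σ ξ ι) j = fireH σ (fireH σ ξ j) ι := by
  funext k
  simp only [fireH]
  ring

lemma sum_simpleRoot (C : CartanADE J) (ι j : J) :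
    ∑ κ : J, simpleRoot ι κ * C.a κ j = C.a ι j := by
  simp [simpleRoot]

lemma reflS_simple {C : CartanADE J} {ι j : J} (h : C.a ι j = 0) :
    reflS C j (simpleRoot ι) = simpleRoot ι := by
  funext k
  simp only [reflS, sum_simpleRoot, h]
  ring

lemma sum_reflS (C : CartanADE J) (ι j : J) (v : J → ℤ) :
    ∑ κ : J, reflS C ι v κ * C.a κ j
      = ∑ κ : J, v κ * C.a κ j - (∑ κ : J, v κ * C.a κ ι) * C.a ι j := by
  rw [← sum_simpleRoot C ι j, Finset.mul_sum, ← Finset.sum_sub_distrib]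
  refine Finset.sum_congr rfl fun κ _ => ?_
  simp only [reflS]
  ring

lemma reflS_comm {C : CartanADE J} {ι j : J} (h : C.a ι j = 0) (v : J → ℤ) :
    reflS C j (reflS C ι v) = reflS C ι (reflS C j v) := by
  have h' : C.a j ι = 0 := by rw [C.symm]; exact h
  funext k
  have e1 := sum_reflS C ι j v
  have e2 := sum_reflS C j ι v
  rw [h] at e1
  rw [h'] at e2
  change reflS C ι v k - (∑ κ : J, reflS C ι v κ * C.a κ j) * simpleRoot j k
    = reflS C j v k - (∑ κ : J, reflS C j v κ * C.a κ ι) * simpleRoot ι k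
  rw [e1, e2]
  simp only [reflS]
  ring

lemma reflS_invol (C : CartanADE J) (ι : J) (v : J → ℤ) :
    reflS C ι (reflS C ι v) = v := by
  funext k
  have e1 := sum_reflS C ι ι v
  rw [C.diag] at e1
  change reflS C ι v k - (∑ κ : J, reflS C ι v κ * C.a κ ι) * simpleRoot ι k = v k
  rw [e1]
  simp only [reflS]
  ring

lemma reflS_inj (C : CartanADE J) (ι : J) : Function.Injective (reflS C ι) :=
  Function.LeftInverse.injective (reflS_invol C ι)

/-- A source occurring in an adapted word can be moved to the front. -/
lemma move_front (C : CartanADE J) (σ : Equiv.Perm J) (ι : J) :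
    ∀ (u : List J) (ξ : J → ℤ), AdL C σ ξ u → IsSource C ξ ι → ι ∈ u →
      ∃ u' : List J, AdL C σ ξ (ι :: u') ∧ (tripL C σ ξ u).Perm (tripL C σ ξ (ι :: u')) := by
  intro u
  induction u with
  | nil => intro ξ _ _ h; simp at h
  | cons j u ih =>
    intro ξ had hs hm
    by_cases hj : ι = j
    · subst hj
      exact ⟨u, had, List.Perm.refl _⟩
    · have hm' : ι ∈ u := by
        rcases List.mem_cons.1 hm with h | h
        · exact absurd h hj
        · exact h
      obtain ⟨hsj, hadu⟩ := had
      have h0 : C.a ι j = 0 := by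
        rcases C.offDiag ι j hj with h | h
        · exact h
        · have h1 := hs j h
          have h2 := hsj ι (by rw [C.symm]; exact h)
          omega
      obtain ⟨r, hr, hp⟩ := ih _ hadu (source_fire σ hs hj) hm'
      refine ⟨j :: r, ⟨hs, source_fire σ hsj (Ne.symm hj), ?_⟩, ?_⟩
      · rw [fireH_comm]; exact hr.2
      · have hp' := (hp.map (fun t => (reflS C j t.1, t.2))).cons (simpleRoot j, j, ξ j)
        refine hp'.trans ?_
        have h0' : C.a j ι = 0 := by rw [C.symm]; exact h0
        simp only [tripL, List.map_cons, List.map_map, reflS_simple h0, reflS_simple h0',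
          fireH_ne σ ξ hj, fireH_ne σ ξ (Ne.symm hj), fireH_comm σ ξ ι j]
        refine (List.Perm.swap _ _ _).trans (List.Perm.of_eq ?_)
        congr 2
        refine List.map_congr_left fun t _ => ?_
        simp only [Function.comp_apply, reflS_comm h0]

/-- If `ι` does not occur in `w`, all the roots of `w` have zero `ι`-coordinate. -/
lemma coord_zero (C : CartanADE J) (σ : Equiv.Perm J) (ι : J) :
    ∀ (w : List J) (ξ : J → ℤ), ι ∉ w → ∀ t ∈ tripL C σ ξ w, t.1 ι = 0 := by
  intro w
  induction w with
  | nil => intro ξ _ t ht; simp [tripL] at ht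
  | cons j w ih =>
    intro ξ hn t ht
    have hj : ι ≠ j := fun h => hn (by simp [h])
    have hw : ι ∉ w := fun h => hn (by simp [h])
    rcases List.mem_cons.1 ht with h | h
    · subst h
      simp [simpleRoot, hj]
    · obtain ⟨s, hs, rfl⟩ := List.mem_map.1 h
      have := ih _ hw s hs
      simp [reflS, simpleRoot, hj, this]

lemma map_fst_cons (C : CartanADE J) (σ : Equiv.Perm J) (ξ : J → ℤ) (ι : J) (w : List J) :
    (tripL C σ ξ (ι :: w)).map Prod.fst = simpleRoot ι ::
      ((tripL C σ (fireH σ ξ ι) w).map Prod.fst).map (reflS C ι) := by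
  simp [tripL, Function.comp_def]

/-- Main combinatorial statement. -/
lemma trip_perm (C : CartanADE J) (σ : Equiv.Perm J) :
    ∀ (v u : List J) (ξ : J → ℤ), AdL C σ ξ u → AdL C σ ξ v →
      ((tripL C σ ξ u).map Prod.fst).Perm ((tripL C σ ξ v).map Prod.fst) →
      (tripL C σ ξ u).Perm (tripL C σ ξ v) := by
  intro v
  induction v with
  | nil =>
    intro u ξ _ _ hp
    have : tripL C σ ξ u = [] := by simpa [tripL] using hp
    rw [this]
    exact List.Perm.refl _
  | cons ι v ih =>
    intro u ξ hu hv hp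
    have hm : ι ∈ u := by
      by_contra hn
      have h1 : simpleRoot ι ∈ (tripL C σ ξ u).map Prod.fst :=
        hp.mem_iff.2 (by rw [map_fst_cons]; simp)
      obtain ⟨t, ht, he⟩ := List.mem_map.1 h1
      have h2 := coord_zero C σ ι u ξ hn t ht
      rw [he] at h2
      simp [simpleRoot] at h2
    obtain ⟨u', hu', hpu⟩ := move_front C σ ι u ξ hu hv.1 hm
    refine hpu.trans ?_
    have hq := (hpu.map Prod.fst).symm.trans hp
    rw [map_fst_cons, map_fst_cons] at hq
    have hq' := (List.map_perm_map_iff (reflS_inj C ι)).1 hq.cons_inv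
    exact ((ih u' _ hu'.2 hv.2 hq').map _).cons _

lemma trip_length (C : CartanADE J) (σ : Equiv.Perm J) :
    ∀ (w : List J) (ξ : J → ℤ), (tripL C σ ξ w).length = w.length := by
  intro w
  induction w with
  | nil => intro ξ; rfl
  | cons j w ih => intro ξ; simp [tripL, ih]

lemma trip_get (C : CartanADE J) (σ : Equiv.Perm J) :
    ∀ (w : List J) (ξ : J → ℤ) (k : ℕ) (h : k < w.length)
      (h' : k < (tripL C σ ξ w).length),
      (tripL C σ ξ w)[k] = (applyRefls C (w.take k) (simpleRoot w[k]), w[k],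
        heightAfter σ ξ (w.take k) w[k]) := by
  intro w
  induction w with
  | nil => intro ξ k h; simp at h
  | cons j w ih =>
    intro ξ k h h'
    cases k with
    | zero => simp [tripL, applyRefls, heightAfter]
    | succ k =>
      have hk : k < w.length := by simpa using h
      have := ih (fireH σ ξ j) k hk (by rw [trip_length]; exact hk)
      simp only [tripL, List.getElem_cons_succ, List.getElem_map, this, List.take_succ_cons]
      rfl

lemma AdL_of (C : CartanADE J) (σ : Equiv.Perm J) :
    ∀ (w : List J) (ξ : J → ℤ),
      (∀ (k : ℕ) (h : k < w.length), IsSource C (heightAfter σ ξ (w.take k)) w[k]) →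
      AdL C σ ξ w := by
  intro w
  induction w with
  | nil => intro ξ _; trivial
  | cons j w ih =>
    intro ξ h
    refine ⟨h 0 (by simp), ih _ fun k hk => ?_⟩
    exact h (k + 1) (by simpa using hk)

lemma trip_ofFn (C : CartanADE J) (σ : Equiv.Perm J) (ξ : J → ℤ) {L : ℕ} (ii : Fin L → J) :
    tripL C σ ξ (List.ofFn ii)
      = List.ofFn (fun k => (betaOf C ii k, ii k, heightAt σ ξ ii k)) := by
  apply List.ext_getElem
  · simp [trip_length]
  · intro k h1 h2
    rw [trip_get C σ _ ξ k (by simpa using h2) h1]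
    simp [betaOf, heightAt]

lemma AdL_ofFn {C : CartanADE J} {D : DiagAut C} {ξ : J → ℤ} {L : ℕ} {ii : Fin L → J}
    (h : IsAdapted C D ξ ii) : AdL C D.σ ξ (List.ofFn ii) := by
  apply AdL_of
  intro k hk
  have := h ⟨k, by simpa using hk⟩
  simpa using this

lemma range_beta {C : CartanADE J} {L : ℕ} {ii : Fin L → J}
    (h : IsReducedWord C ii) (hL : 0 < L) : Set.range (betaOf C ii) = posRoots C := by
  obtain ⟨h1, h2, h3⟩ := h
  have hfin : (posRoots C).Finite := Set.finite_of_ncard_ne_zero (by omega)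
  apply Set.eq_of_subset_of_ncard_le _ _ hfin
  · rintro _ ⟨k, rfl⟩
    exact h3 k
  · rw [← Set.image_univ, Set.ncard_image_of_injective _ h2, Set.ncard_univ]
    simp [← h1]

/-- the map `Ω̃_Q : R⁺ → J × ℤ`, `β_k ↦ (ι_k, (s_{ι_{k−1}}⋯s_{ι_1}ξ)_{ι_k})`,
does not depend on the choice of a Q-adapted reduced word. -/
theorem statement5 (C : CartanADE J) (D : DiagAut C) (ξ : J → ℤ)
    (hξ : IsHeightFunction C D ξ) (L : ℕ) (ii jj : Fin L → J)
    (hir : IsReducedWord C ii) (hia : IsAdapted C D ξ ii)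
    (hjr : IsReducedWord C jj) (hja : IsAdapted C D ξ jj) :
    ∀ k k' : Fin L, betaOf C ii k = betaOf C jj k' →
      ii k = jj k' ∧ heightAt D.σ ξ ii k = heightAt D.σ ξ jj k' := by
  intro k k' hk
  have hL : 0 < L := lt_of_le_of_lt (Nat.zero_le _) k.2
  have hfst : ∀ w : Fin L → J, (tripL C D.σ ξ (List.ofFn w)).map Prod.fst
      = List.ofFn (betaOf C w) := by
    intro w
    rw [trip_ofFn, List.map_ofFn]
    rfl
  have hperm : (List.ofFn (betaOf C ii)).Perm (List.ofFn (betaOf C jj)) := by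
    rw [List.perm_ext_iff_of_nodup (List.nodup_ofFn.2 hir.2.1) (List.nodup_ofFn.2 hjr.2.1)]
    intro x
    rw [List.mem_ofFn', List.mem_ofFn', range_beta hir hL, range_beta hjr hL]
  have hP := trip_perm C D.σ (List.ofFn jj) (List.ofFn ii) ξ (AdL_ofFn hia) (AdL_ofFn hja)
    (by rw [hfst, hfst]; exact hperm)
  rw [trip_ofFn, trip_ofFn] at hP
  have hmem : (betaOf C ii k, ii k, heightAt D.σ ξ ii k) ∈
      List.ofFn (fun k => (betaOf C jj k, jj k, heightAt D.σ ξ jj k)) :=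
    hP.mem_iff.1 (List.mem_ofFn.2 ⟨k, rfl⟩)
  obtain ⟨m, hm⟩ := List.mem_ofFn.1 hmem
  simp only [Prod.mk.injEq] at hm
  have : m = k' := hjr.2.1 (hm.1.trans hk)
  subst this
  exact ⟨hm.2.1.symm, hm.2.2.symm⟩

end QDatumPaper
end
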